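/- Let F = ℚ(√z) be a real quadratic field, where z is a square-free positive integer with exactly s+1 distinct prime divisors, none of which is congruent to 3 mod 4. Then 2^s divides the class number of F. -/

import Mathlib

theorem Nat.eq_of_squarefree_of_isSquare_mul {d e : ℕ} (hd : Squarefree d) (he : Squarefree e)
    (h : IsSquare (d * e)) : d = e := by
  have key : ∀ {a b : ℕ}, Squarefree a → IsSquare (a * b) → ∀ p : ℕ, p.Prime → p ∣ a → p ∣ b := by
    rintro a b ha ⟨n, hn⟩ p hp hpa
    have hpn : p ∣ n := by
      have : p ∣ n * n := hn ▸ hpa.mul_right b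
      exact (hp.dvd_mul.mp this).elim id id
    by_contra hpb
    have h2 : p * p ∣ a * b := hn ▸ mul_dvd_mul hpn hpn
    have hc : (p * p).Coprime b :=
      Nat.Coprime.mul_left ((hp.coprime_iff_not_dvd).mpr hpb) ((hp.coprime_iff_not_dvd).mpr hpb)
    exact hp.not_isUnit (ha p (hc.dvd_of_dvd_mul_right h2))
  rw [← Nat.prod_primeFactors_of_squarefree hd, ← Nat.prod_primeFactors_of_squarefree he]
  congr 1
  ext p
  simp only [Nat.mem_primeFactors]
  exact ⟨fun ⟨hp, h1, _⟩ => ⟨hp, key hd h p hp h1, he.ne_zero⟩,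
    fun ⟨hp, h1, _⟩ => ⟨hp, key he (mul_comm d e ▸ h) p hp h1, hd.ne_zero⟩⟩

theorem Nat.card_divisors_of_squarefree {n : ℕ} (hn : Squarefree n) :
    n.divisors.card = 2 ^ n.primeFactors.card := by
  rw [Nat.card_divisors hn.ne_zero, Finset.prod_congr rfl (g := fun _ => 2), Finset.prod_const]
  intro p hp
  have hp' := Nat.mem_primeFactors.mp hp
  have h1 := hn.natFactorization_le_one p
  have h2 := hp'.1.factorization_pos_of_dvd hn.ne_zero hp'.2.1
  omega

theorem exists_eq_sq_add_sq_odd {z : ℕ} (hsq : Squarefree z)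
    (hmod : ∀ p ∈ z.primeFactors, p % 4 ≠ 3) :
    ∃ x y : ℕ, z = x ^ 2 + y ^ 2 ∧ Odd x ∧ x.Coprime y := by
  obtain ⟨x, y, h⟩ := Nat.eq_sq_add_sq_of_isSquare_mod_neg_one
    ((ZMod.isSquare_neg_one_iff_forall_mem_primeFactors_mod_four_ne_three hsq).mpr hmod)
  have hc : x.Coprime y := by
    rw [Nat.coprime_iff_gcd_eq_one, ← Nat.isUnit_iff]
    refine hsq _ ?_
    rw [h, ← sq]
    exact dvd_add (pow_dvd_pow_of_dvd (Nat.gcd_dvd_left x y) 2)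
      (pow_dvd_pow_of_dvd (Nat.gcd_dvd_right x y) 2)
  rcases Nat.even_or_odd x with hx | hx
  · refine ⟨y, x, by rw [h, add_comm], ?_, hc.symm⟩
    by_contra hy
    exact Nat.not_coprime_of_dvd_of_dvd one_lt_two hx.two_dvd
      (Nat.not_odd_iff_even.mp hy).two_dvd hc
  · exact ⟨x, y, h, hx, hc⟩

theorem Ideal.span_pair_sq_eq_span_singleton {R : Type*} [CommRing R] {a b r u v w : R}
    (h : r ^ 2 = a * b) (hu : u * a + v * r + w * b = 1) :
    Ideal.span {a, r} ^ 2 = Ideal.span {a} := by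
  rw [sq, Ideal.span_pair_mul_span_pair]
  apply le_antisymm
  · rw [Ideal.span_le]
    simp only [Set.insert_subset_iff, Set.singleton_subset_iff, SetLike.mem_coe,
      Ideal.mem_span_singleton]
    exact ⟨dvd_mul_right _ _, dvd_mul_right _ _, dvd_mul_left _ _, ⟨b, by rw [← h, sq]⟩⟩
  · rw [Ideal.span_singleton_le_iff_mem]
    have h1 : a = u * (a * a) + v * (a * r) + w * (r * r) := by
      linear_combination (-a) * hu - w * h
    have h2 : u * (a * a) + v * (a * r) + w * (r * r) ∈
        Ideal.span {a * a, a * r, r * a, r * r} := by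
      refine add_mem (add_mem ?_ ?_) ?_ <;>
        exact Ideal.mul_mem_left _ _ (Ideal.subset_span (by simp))
    rwa [← h1] at h2

section RealQuadratic

variable {F : Type*} [Field F] [NumberField F]

theorem exists_eq_add_mul_of_sq_eq {z : ℕ} (hz : ¬ IsSquare z) (hdeg : Module.finrank ℚ F = 2)
    {r : F} (hr : r ^ 2 = z) (g : F) : ∃ a b : ℚ, g = a + b * r := by
  have hind : LinearIndependent ℚ ![(1 : F), r] := by
    rw [LinearIndependent.pair_iff]
    intro a b hab
    simp only [Algebra.smul_def, eq_ratCast, mul_one] at hab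
    have hb : b = 0 := by
      by_contra hb
      apply hz
      rw [← Rat.isSquare_natCast_iff]
      refine ⟨a / b, ?_⟩
      have hbF : (b : F) ≠ 0 := by exact_mod_cast hb
      have h2 : (a : F) ^ 2 = b ^ 2 * z := by
        linear_combination (a - b * r) * hab + b ^ 2 * hr
      have h3 : a ^ 2 = b ^ 2 * z := by exact_mod_cast h2
      field_simp
      linarith
    subst hb
    simpa using hab
  have htop := hind.span_eq_top_of_card_eq_finrank' (by simp [hdeg])
  have hg : g ∈ Submodule.span ℚ (Set.range ![(1 : F), r]) := htop ▸ Submodule.mem_top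
  simp only [Matrix.range_cons, Matrix.range_empty, Set.union_empty, Set.singleton_union,
    Submodule.mem_span_pair] at hg
  obtain ⟨a, b, h⟩ := hg
  exact ⟨a, b, by simpa [Algebra.smul_def] using h.symm⟩

theorem coeffs_eq_of_sq_eq {z : ℕ} (hz : ¬ IsSquare z) {r : F} (hr : r ^ 2 = z) {a b c d : ℚ}
    (h : (a : F) + b * r = c + d * r) : a = c ∧ b = d := by
  have hbd : b = d := by
    by_contra hb
    have hb' : b - d ≠ 0 := sub_ne_zero.mpr hb
    apply hz
    rw [← Rat.isSquare_natCast_iff]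
    refine ⟨(a - c) / (b - d), ?_⟩
    have h2 : ((a : F) - c) ^ 2 = (b - d) ^ 2 * z := by
      linear_combination (a - c - (b - d) * r) * h + (b - d) ^ 2 * hr
    have h3 : (a - c) ^ 2 = (b - d) ^ 2 * z := by exact_mod_cast h2
    field_simp
    linarith
  subst hbd
  exact ⟨by exact_mod_cast add_right_cancel h, rfl⟩

open NumberField nonZeroDivisors

theorem im_map_eq_zero_of_real_quadratic {z : ℕ} (hz0 : 0 < z) (hz : ¬ IsSquare z)
    (hdeg : Module.finrank ℚ F = 2) {r : F} (hr : r ^ 2 = z) (φ : F →+* ℂ) (g : F) :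
    (φ g).im = 0 := by
  have h1 : φ r ^ 2 = z := by rw [← map_pow, hr, map_natCast]
  have hre := congrArg Complex.re h1
  have him := congrArg Complex.im h1
  simp only [sq, Complex.mul_re, Complex.mul_im, Complex.natCast_re, Complex.natCast_im]
    at hre him
  have hr0 : (φ r).im = 0 := by
    by_contra h
    have : (φ r).re = 0 := by
      have : (φ r).re * (φ r).im = 0 := by linarith
      exact (mul_eq_zero.mp this).resolve_right h
    have hz' : (0 : ℝ) < z := by exact_mod_cast hz0
    rw [this] at hre
    nlinarith [mul_self_nonneg (φ r).im]
  obtain ⟨a, b, rfl⟩ := exists_eq_add_mul_of_sq_eq hz hdeg hr g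
  simp [hr0]

theorem torsion_eq_one_or_neg_one_of_real_quadratic {z : ℕ} (hz0 : 0 < z) (hz : ¬ IsSquare z)
    (hdeg : Module.finrank ℚ F = 2) {r : F} (hr : r ^ 2 = z) {ζ : (𝓞 F)ˣ}
    (hζ : ζ ∈ Units.torsion F) : ζ = 1 ∨ ζ = -1 := by
  obtain ⟨w⟩ : Nonempty (InfinitePlace F) := inferInstance
  have h1 := (Units.mem_torsion F).mp hζ w
  rw [← InfinitePlace.norm_embedding_eq] at h1
  have him := im_map_eq_zero_of_real_quadratic hz0 hz hdeg hr w.embedding (ζ : F)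
  have hsq : w.embedding (ζ : F) ^ 2 = 1 := by
    have h2 : w.embedding (ζ : F) = ((w.embedding (ζ : F)).re : ℂ) := Complex.ext rfl (by simpa)
    rw [h2] at h1 ⊢
    rw [Complex.norm_real, Real.norm_eq_abs] at h1
    rw [← Complex.ofReal_pow, ← sq_abs, h1]
    simp
  rw [← map_pow, map_eq_one_iff _ w.embedding.injective, sq_eq_one_iff] at hsq
  refine hsq.imp (fun h => ?_) (fun h => ?_)
  · ext
    simpa using h
  · ext
    simpa using h

theorem exists_unit_sq_or_neg_sq {z : ℕ} (hz0 : 0 < z) (hz : ¬ IsSquare z)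
    (hdeg : Module.finrank ℚ F = 2) {r : F} (hr : r ^ 2 = z) (u v : (𝓞 F)ˣ) :
    (∃ w, u = w ^ 2 ∨ u = -w ^ 2) ∨ (∃ w, v = w ^ 2 ∨ v = -w ^ 2) ∨
      ∃ w, u * v = w ^ 2 ∨ u * v = -w ^ 2 := by
  have hrank : Units.rank F ≤ 1 := by
    have h1 := InfinitePlace.card_add_two_mul_card_eq_rank F
    have h2 := InfinitePlace.card_eq_nrRealPlaces_add_nrComplexPlaces F
    rw [Units.rank]
    omega
  obtain ⟨ε, hε⟩ : ∃ ε : (𝓞 F)ˣ, ∀ u : (𝓞 F)ˣ, ∃ n : ℤ, u = ε ^ n ∨ u = -ε ^ n := by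
    have key : ∃ ε : (𝓞 F)ˣ, ∀ n : Fin (Units.rank F) → ℤ,
        ∃ m : ℤ, ∏ i, Units.fundSystem F i ^ n i = ε ^ m := by
      generalize Units.fundSystem F = f
      generalize Units.rank F = k at hrank f
      interval_cases k
      · exact ⟨1, fun n => ⟨0, by simp⟩⟩
      · exact ⟨f 0, fun n => ⟨n 0, by simp⟩⟩
    obtain ⟨ε, hε⟩ := key
    refine ⟨ε, fun u => ?_⟩
    obtain ⟨⟨ζ, n⟩, hu, -⟩ := Units.exist_unique_eq_mul_prod F u
    obtain ⟨m, hm⟩ := hε n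
    simp only [hm] at hu
    refine ⟨m, ?_⟩
    rcases torsion_eq_one_or_neg_one_of_real_quadratic hz0 hz hdeg hr ζ.2 with h | h <;>
      simp [hu, h]
  have heven : ∀ u : (𝓞 F)ˣ, (∃ n : ℤ, Even n ∧ (u = ε ^ n ∨ u = -ε ^ n)) →
      ∃ w, u = w ^ 2 ∨ u = -w ^ 2 := by
    rintro u ⟨n, ⟨m, rfl⟩, h⟩
    refine ⟨ε ^ m, ?_⟩
    rwa [sq, ← zpow_add]
  obtain ⟨m, hm⟩ := hε u
  obtain ⟨n, hn⟩ := hε v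
  rcases Int.even_or_odd m with h1 | h1
  · exact Or.inl (heven u ⟨m, h1, hm⟩)
  rcases Int.even_or_odd n with h2 | h2
  · exact Or.inr (Or.inl (heven v ⟨n, h2, hn⟩))
  refine Or.inr (Or.inr (heven _ ⟨m + n, h1.add_odd h2, ?_⟩))
  rw [zpow_add]
  rcases hm with rfl | rfl <;> rcases hn with rfl | rfl <;> simp

/-- The elements `d * (r + y) ^ e` with `e ∈ {0, 1}`. -/
def selmerElement {R : Type*} [CommRing R] (r : R) (y : ℕ) (i : ℕ × Bool) : R :=
  i.1 * if i.2 then r + y else 1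

theorem eq_of_sq_eq_natCast {z p d e : ℕ} (hz0 : 0 < z) (hz : ¬ IsSquare z)
    (hsq : Squarefree z) (hp : p.Prime) (hpz : p ∣ z) (hd : d ∣ z / p) (he : e ∣ z / p)
    (hdeg : Module.finrank ℚ F = 2) {r : F} (hr : r ^ 2 = z) {g : F}
    (h : (d : F) * e = g ^ 2 ∨ (d : F) * e = -g ^ 2) : d = e := by
  obtain ⟨k, rfl⟩ := hpz
  rw [Nat.mul_div_cancel_left k hp.pos] at hd he
  have hk : Squarefree k := hsq.of_mul_right
  have hk0 := hk.ne_zero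
  have hd0 : 0 < d := Nat.pos_of_dvd_of_pos hd (Nat.pos_of_ne_zero hk0)
  have he0 : 0 < e := Nat.pos_of_dvd_of_pos he (Nat.pos_of_ne_zero hk0)
  have hpk : ¬ p ∣ k := fun hpk => hp.not_isUnit (hsq p (mul_dvd_mul_left p hpk))
  have hde : (0 : ℚ) < d * e := by positivity
  have hzQ : (0 : ℚ) < (p * k : ℕ) := by exact_mod_cast hz0
  obtain ⟨a, b, rfl⟩ := exists_eq_add_mul_of_sq_eq hz hdeg hr g
  have hab : a * b = 0 ∧ (d * e : ℚ) = a ^ 2 + b ^ 2 * (p * k : ℕ) := by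
    have hexp : ((a : F) + b * r) ^ 2
        = ((a ^ 2 + b ^ 2 * (p * k : ℕ) : ℚ) : F) + ((2 * (a * b) : ℚ) : F) * r := by
      push_cast at hr ⊢
      linear_combination b ^ 2 * hr
    rcases h with h | h
    · have := coeffs_eq_of_sq_eq hz hr (a := d * e) (b := 0)
        (c := a ^ 2 + b ^ 2 * (p * k : ℕ)) (d := 2 * (a * b)) (by rw [← hexp, ← h]; simp)
      exact ⟨by linarith [this.2], this.1⟩
    · have := coeffs_eq_of_sq_eq hz hr (a := -(d * e)) (b := 0)
        (c := a ^ 2 + b ^ 2 * (p * k : ℕ)) (d := 2 * (a * b))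
        (by rw [← hexp, ← neg_eq_iff_eq_neg.mpr h]; simp)
      nlinarith [this.1, mul_nonneg (sq_nonneg b) hzQ.le, sq_nonneg a]
  obtain ⟨hab, hde'⟩ := hab
  rcases mul_eq_zero.mp hab with rfl | rfl
  · exfalso
    have hs : IsSquare (d * e * (p * k)) := by
      rw [← Rat.isSquare_natCast_iff]
      refine ⟨b * (p * k : ℕ), ?_⟩
      rw [Nat.cast_mul, Nat.cast_mul d, hde']
      ring
    obtain ⟨n, hn⟩ := hs
    have hpn : p ∣ n := by
      have : p ∣ n * n := ⟨d * e * k, by rw [← hn]; ring⟩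
      exact (hp.dvd_mul.mp this).elim id id
    have h2 : p * p ∣ p * (d * e * k) := by
      rw [show p * (d * e * k) = n * n by rw [← hn]; ring]
      exact mul_dvd_mul hpn hpn
    have h3 := Nat.dvd_of_mul_dvd_mul_left hp.pos h2
    rcases hp.dvd_mul.mp h3 with h4 | h4
    · exact (hp.dvd_mul.mp h4).elim (fun h => hpk (h.trans hd)) (fun h => hpk (h.trans he))
    · exact hpk h4
  · refine Nat.eq_of_squarefree_of_isSquare_mul (hk.squarefree_of_dvd hd)
      (hk.squarefree_of_dvd he) ?_
    rw [← Rat.isSquare_natCast_iff]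
    refine ⟨a, ?_⟩
    rw [Nat.cast_mul, hde']
    ring

theorem natCast_mul_root_add_ne_sq {z x y n : ℕ} (hz : ¬ IsSquare z)
    (hxy : z = x ^ 2 + y ^ 2) (hx : x ≠ 0) (hn : n ≠ 0)
    (hdeg : Module.finrank ℚ F = 2) {r : F} (hr : r ^ 2 = z) {g : F} :
    ¬ ((n : F) * (r + y) = g ^ 2 ∨ (n : F) * (r + y) = -g ^ 2) := by
  intro h
  obtain ⟨a, b, rfl⟩ := exists_eq_add_mul_of_sq_eq hz hdeg hr g
  have hexp : ((a : F) + b * r) ^ 2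
      = ((a ^ 2 + b ^ 2 * z : ℚ) : F) + ((2 * (a * b) : ℚ) : F) * r := by
    push_cast
    linear_combination b ^ 2 * hr
  have hnorm : (n * x : ℚ) ^ 2 + (a ^ 2 - z * b ^ 2) ^ 2 = 0 := by
    have hz' : (z : ℚ) = x ^ 2 + y ^ 2 := by exact_mod_cast hxy
    rcases h with h | h
    · obtain ⟨h1, h2⟩ := coeffs_eq_of_sq_eq hz hr (a := n * y) (b := n)
        (c := a ^ 2 + b ^ 2 * z) (d := 2 * (a * b)) (by rw [← hexp, ← h]; push_cast; ring)
      linear_combination (n * y + (a ^ 2 + b ^ 2 * z)) * (-h1) + z * (n + 2 * (a * b)) * h2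
        - n ^ 2 * hz'
    · obtain ⟨h1, h2⟩ := coeffs_eq_of_sq_eq hz hr (a := -(n * y)) (b := -n)
        (c := a ^ 2 + b ^ 2 * z) (d := 2 * (a * b))
        (by rw [← hexp, ← neg_eq_iff_eq_neg.mpr h]; push_cast; ring)
      linear_combination (-n * y + (a ^ 2 + b ^ 2 * z)) * (-h1)
        + z * (-n + 2 * (a * b)) * h2 - n ^ 2 * hz'
  have : (0 : ℚ) < (n * x) ^ 2 := by positivity
  nlinarith [sq_nonneg (a ^ 2 - z * b ^ 2)]

theorem selmerElement_injective {z p x y : ℕ} (hz0 : 0 < z) (hz : ¬ IsSquare z)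
    (hsq : Squarefree z) (hp : p.Prime) (hpz : p ∣ z) (hxy : z = x ^ 2 + y ^ 2) (hx : x ≠ 0)
    (hdeg : Module.finrank ℚ F = 2) {r : F} (hr : r ^ 2 = z) {i j : ℕ × Bool}
    (hi : i.1 ∣ z / p) (hj : j.1 ∣ z / p) {g : F}
    (h : selmerElement r y i * selmerElement r y j = g ^ 2 ∨
      selmerElement r y i * selmerElement r y j = -g ^ 2) : i = j := by
  obtain ⟨d, e⟩ := i
  obtain ⟨d', e'⟩ := j
  have hk : 0 < z / p := Nat.div_pos (Nat.le_of_dvd hz0 hpz) hp.pos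
  have hd0 : d ≠ 0 := (Nat.pos_of_dvd_of_pos hi hk).ne'
  have hd0' : d' ≠ 0 := (Nat.pos_of_dvd_of_pos hj hk).ne'
  have hmixed := natCast_mul_root_add_ne_sq hz hxy hx (mul_ne_zero hd0 hd0') hdeg hr (g := g)
  have heq := fun g => eq_of_sq_eq_natCast hz0 hz hsq hp hpz hi hj hdeg hr (g := g)
  have hβ : r + y ≠ 0 := by
    intro h0
    have h1 : (x : F) ^ 2 = 0 := by
      have : (z : F) = x ^ 2 + y ^ 2 := by exact_mod_cast hxy
      linear_combination (r - y) * h0 - hr - this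
    exact hx (by exact_mod_cast pow_eq_zero_iff two_ne_zero |>.mp h1)
  rcases e with _ | _ <;> rcases e' with _ | _ <;> simp only [selmerElement, if_true, mul_one,
    Bool.false_eq_true, if_false] at h hi hj
  · exact Prod.ext (heq g h) rfl
  · exact absurd (by rw [Nat.cast_mul, mul_assoc]; exact h) hmixed
  · exact absurd (by rw [Nat.cast_mul, mul_assoc, mul_comm (d' : F), ← mul_assoc]; exact h) hmixed
  · refine Prod.ext (heq (g / (r + y)) ?_) rfl
    rw [div_pow, ← neg_div, eq_div_iff (pow_ne_zero 2 hβ), eq_div_iff (pow_ne_zero 2 hβ)]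
    convert h using 2 <;> ring

theorem mk0_sq_eq_one_of_sq_eq_span {R : Type*} [CommRing R] [IsDedekindDomain R]
    {I : (Ideal R)⁰} {a : R} (hI : (I : Ideal R) ^ 2 = Ideal.span {a}) :
    ClassGroup.mk0 I ^ 2 = 1 := by
  obtain ⟨K, hK⟩ : ∃ K, K = I ^ 2 := ⟨_, rfl⟩
  have hKa : (K : Ideal R) = Ideal.span {a} := by
    rw [hK, SubmonoidClass.coe_pow, hI]
  rw [← map_pow, ← hK]
  exact (ClassGroup.mk0_eq_one_iff K.2).mpr ⟨a, hKa⟩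

theorem exists_unit_mul_sq_of_mk0_eq {I J : (Ideal (𝓞 F))⁰} {a b : 𝓞 F}
    (hI : (I : Ideal (𝓞 F)) ^ 2 = Ideal.span {a}) (hJ : (J : Ideal (𝓞 F)) ^ 2 = Ideal.span {b})
    (h : ClassGroup.mk0 I = ClassGroup.mk0 J) :
    ∃ (u : (𝓞 F)ˣ) (g : F), (a : F) * b = u * g ^ 2 := by
  obtain ⟨x, y, hx, hy, hxy⟩ := ClassGroup.mk0_eq_mk0_iff.mp h
  have h2 := congrArg (· ^ 2) hxy
  simp only [mul_pow, hI, hJ, Ideal.span_singleton_pow, Ideal.span_singleton_mul_span_singleton]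
    at h2
  obtain ⟨u, hu⟩ := Ideal.span_singleton_eq_span_singleton.mp h2
  have hu' : (x : F) ^ 2 * a * u = y ^ 2 * b := by exact_mod_cast congrArg (algebraMap (𝓞 F) F) hu
  have hy' : (y : F) ≠ 0 := by simpa using hy
  refine ⟨u, x * a / y, ?_⟩
  field_simp
  linear_combination (-(a : F)) * hu'

theorem exists_ideal_sq_eq_span_selmerElement {R : Type*} [CommRing R] {z x y : ℕ}
    (hsq : Squarefree z) (hxy : z = x ^ 2 + y ^ 2) (hodd : Odd x) (hc : x.Coprime y) {r : R}
    (hr : r ^ 2 = z) {i : ℕ × Bool} (hi : i.1 ∣ z) :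
    ∃ J : Ideal R, J ^ 2 = Ideal.span {selmerElement r y i} := by
  obtain ⟨d, e⟩ := i
  obtain ⟨k, rfl⟩ := hi
  have hdk : IsCoprime (d : ℤ) k :=
    Nat.isCoprime_iff_coprime.mpr (Nat.coprime_of_squarefree_mul hsq)
  obtain ⟨s, t, hst⟩ := hdk
  have hst' : (s : R) * d + t * k = 1 := by exact_mod_cast congrArg (Int.cast : ℤ → R) hst
  have hd : Ideal.span {(d : R), r} ^ 2 = Ideal.span {(d : R)} :=
    Ideal.span_pair_sq_eq_span_singleton (b := (k : R)) (u := s) (v := 0) (w := t)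
      (by rw [hr]; push_cast; ring) (by linear_combination hst')
  have hxy2 : IsCoprime (x : ℤ) (2 * y : ℕ) := Nat.isCoprime_iff_coprime.mpr
    (Nat.Coprime.mul_right hodd.coprime_two_right hc)
  obtain ⟨m, n, hmn⟩ := hxy2
  have hmn' : (m : R) * x + n * (2 * y) = 1 := by
    exact_mod_cast congrArg (Int.cast : ℤ → R) hmn
  have hβ : Ideal.span {r + (y : R), (x : R)} ^ 2 = Ideal.span {r + (y : R)} := by
    have hxyR : ((d * k : ℕ) : R) = x ^ 2 + y ^ 2 := by
      exact_mod_cast congrArg (Nat.cast : ℕ → R) hxy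
    exact Ideal.span_pair_sq_eq_span_singleton (b := r - y) (u := n) (v := m) (w := -n)
      (by linear_combination -hr - hxyR) (by linear_combination hmn')
  rcases e with _ | _
  · exact ⟨_, by simpa [selmerElement] using hd⟩
  · refine ⟨Ideal.span {(d : R), r} * Ideal.span {r + (y : R), (x : R)}, ?_⟩
    rw [mul_pow, hd, hβ, Ideal.span_singleton_mul_span_singleton]
    simp [selmerElement]

theorem two_pow_dvd_card_of_forall_sq_eq_one {G : Type*} [CommGroup G] [Finite G] {s : ℕ}
    {T : Finset G} (hT : ∀ g ∈ T, g ^ 2 = 1) (hs : 2 ^ s ≤ T.card) : 2 ^ s ∣ Nat.card G := by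
  have hp : IsPGroup 2 (powMonoidHom 2 : G →* G).ker := fun g => ⟨1, by
    ext
    simpa using MonoidHom.mem_ker.mp g.2⟩
  obtain ⟨n, hn⟩ := IsPGroup.iff_card.mp hp
  have hle : T.card ≤ Nat.card (powMonoidHom 2 : G →* G).ker := by
    rw [← Set.ncard_coe_finset]
    exact Set.ncard_le_ncard (t := ((powMonoidHom 2 : G →* G).ker : Set G))
      (fun g hg => MonoidHom.mem_ker.mpr (hT g hg)) (Set.toFinite _)
  rw [hn] at hle
  have hsn := (Nat.pow_le_pow_iff_right one_lt_two).mp (hs.trans hle)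
  exact (pow_dvd_pow 2 hsn).trans (hn ▸ Subgroup.card_subgroup_dvd_card _)

end RealQuadratic

/-- If `z` is a square-free positive integer with exactly `s + 1` distinct prime
divisors, none of which is congruent to `3` mod `4`, then `2 ^ s` divides the class
number of the real quadratic field `ℚ(√z)`. -/
theorem two_pow_dvd_classNumber_real_quad_no_three_mod_four (z s : ℕ) (hz : 0 < z)
    (hsq : Squarefree z) (hfac : z.primeFactors.card = s + 1)
    (hmod : ∀ p ∈ z.primeFactors, p % 4 ≠ 3)
    (F : Type) [Field F] [NumberField F] (hdeg : Module.finrank ℚ F = 2)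
    (hgen : ∃ α : F, α ^ 2 = (z : F)) :
    2 ^ s ∣ NumberField.classNumber F := by
  classical
  obtain ⟨r, hr⟩ := hgen
  obtain ⟨p, hp⟩ : z.primeFactors.Nonempty := Finset.card_pos.mp (by omega)
  have hpp := Nat.prime_of_mem_primeFactors hp
  have hpz := Nat.dvd_of_mem_primeFactors hp
  have hns : ¬ IsSquare z := by
    rintro ⟨n, rfl⟩
    have hn := Nat.isUnit_iff.mp (hsq n dvd_rfl)
    subst hn
    simp at hfac
  obtain ⟨x, y, hxy, hodd, hc⟩ := exists_eq_sq_add_sq_odd hsq hmod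
  have hx0 : x ≠ 0 := hodd.pos.ne'
  obtain ⟨ρ, rfl⟩ : ∃ ρ : NumberField.RingOfIntegers F, (ρ : F) = r :=
    ⟨⟨r, IsIntegral.of_pow two_pos (hr ▸ isIntegral_natCast z)⟩, rfl⟩
  have hρ : ρ ^ 2 = z := by
    apply NumberField.RingOfIntegers.ext
    simpa using hr
  have hcoe (i : ℕ × Bool) : ((selmerElement ρ y i : NumberField.RingOfIntegers F) : F) =
      selmerElement (ρ : F) y i := by
    rcases i with ⟨d, _ | _⟩ <;> simp [selmerElement]
  have hk : Squarefree (z / p) := hsq.squarefree_of_dvd (Nat.div_dvd_of_dvd hpz)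
  set X : Finset (ℕ × Bool) := (z / p).divisors ×ˢ Finset.univ with hX
  have hdvd {i : ℕ × Bool} (hi : i ∈ X) : i.1 ∣ z / p :=
    Nat.dvd_of_mem_divisors (Finset.mem_product.mp hi).1
  have hinj {i j : ℕ × Bool} (hi : i ∈ X) (hj : j ∈ X) {g : F}
      (h : selmerElement (ρ : F) y i * selmerElement (ρ : F) y j = g ^ 2 ∨
        selmerElement (ρ : F) y i * selmerElement (ρ : F) y j = -g ^ 2) : i = j :=
    selmerElement_injective hz hns hsq hpp hpz hxy hx0 hdeg hr (hdvd hi) (hdvd hj) h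
  have hne (i : ℕ × Bool) (hi : i ∈ X) : selmerElement ρ y i ≠ 0 := by
    intro h0
    have hone : ((1, false) : ℕ × Bool) ∈ X := by simpa [hX] using hk.ne_zero
    have hi1 : i = (1, false) := hinj hi hone (g := 0) (by rw [← hcoe, h0]; simp)
    subst hi1
    simp [selmerElement] at h0
  have hclass (i : ℕ × Bool) : ∃ J : nonZeroDivisors (Ideal (NumberField.RingOfIntegers F)),
      i ∈ X → (J : Ideal (NumberField.RingOfIntegers F)) ^ 2 =
        Ideal.span {selmerElement ρ y i} := by
    by_cases hi : i ∈ X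
    · obtain ⟨J, hJ⟩ := exists_ideal_sq_eq_span_selmerElement hsq hxy hodd hc hρ
        ((hdvd hi).trans (Nat.div_dvd_of_dvd hpz))
      refine ⟨⟨J, mem_nonZeroDivisors_of_ne_zero ?_⟩, fun _ => hJ⟩
      rintro rfl
      apply hne i hi
      rw [← Ideal.span_singleton_eq_bot, ← hJ]
      exact zero_pow two_ne_zero
    · exact ⟨1, fun h => absurd h hi⟩
  choose J hJ using hclass
  let c (i : ℕ × Bool) := ClassGroup.mk0 (J i)
  have hfiber (b) (_ : b ∈ X.image c) : (X.filter (c · = b)).card ≤ 2 := by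
    by_contra! hlt
    obtain ⟨i, hi, j, hj, k, hk, hij, hik, hjk⟩ := Finset.two_lt_card.mp hlt
    rw [Finset.mem_filter] at hi hj hk
    obtain ⟨u, g, hu⟩ := exists_unit_mul_sq_of_mk0_eq (hJ i hi.1) (hJ j hj.1)
      (hi.2.trans hj.2.symm)
    obtain ⟨v, h, hv⟩ := exists_unit_mul_sq_of_mk0_eq (hJ i hi.1) (hJ k hk.1)
      (hi.2.trans hk.2.symm)
    have hi0 : selmerElement (ρ : F) y i ≠ 0 := by
      rw [← hcoe]
      simpa using hne i hi.1
    rw [hcoe, hcoe] at hu hv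
    rcases exists_unit_sq_or_neg_sq hz hns hdeg hr u v with ⟨w, hw⟩ | ⟨w, hw⟩ | ⟨w, hw⟩
    · refine hij (hinj hi.1 hj.1 (g := w * g) ?_)
      rw [hu]
      refine hw.imp ?_ ?_ <;> rintro rfl <;> push_cast <;> ring
    · refine hik (hinj hi.1 hk.1 (g := w * h) ?_)
      rw [hv]
      refine hw.imp ?_ ?_ <;> rintro rfl <;> push_cast <;> ring
    · refine hjk (hinj hj.1 hk.1 (g := w * g * h / selmerElement (ρ : F) y i) ?_)
      rw [div_pow, ← neg_div, eq_div_iff (pow_ne_zero 2 hi0), eq_div_iff (pow_ne_zero 2 hi0)]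
      have huv : selmerElement (ρ : F) y j * selmerElement (ρ : F) y k *
          selmerElement (ρ : F) y i ^ 2 = ((u * v : (NumberField.RingOfIntegers F)ˣ) : F) *
            (g * h) ^ 2 := by
        push_cast
        linear_combination hu * selmerElement (ρ : F) y i * selmerElement (ρ : F) y k +
          u * g ^ 2 * hv
      rw [huv]
      refine hw.imp ?_ ?_ <;> intro hw <;> rw [hw] <;> push_cast <;> ring
  have hcard : X.card = 2 ^ s * 2 := by
    have hpk : (z / p).primeFactors.card = s := by
      have hmul := Nat.mul_div_cancel' hpz
      have hcop : p.Coprime (z / p) := Nat.coprime_of_squarefree_mul (by rwa [hmul])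
      rw [← hmul, hcop.primeFactors_mul, Finset.card_union_of_disjoint hcop.disjoint_primeFactors,
        hpp.primeFactors, Finset.card_singleton] at hfac
      omega
    rw [hX, Finset.card_product, Nat.card_divisors_of_squarefree hk, hpk]
    simp
  have hsq_one : ∀ b ∈ X.image c, b ^ 2 = 1 := by
    intro b hb
    obtain ⟨i, hi, rfl⟩ := Finset.mem_image.mp hb
    exact mk0_sq_eq_one_of_sq_eq_span (hJ i hi)
  rw [NumberField.classNumber, ← Nat.card_eq_fintype_card]
  have hle := Finset.card_le_mul_card_image X 2 hfiber
  exact two_pow_dvd_card_of_forall_sq_eq_one hsq_one (by omega)
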